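/- arXiv:2211.00412 — 3 statements merged into one kernel-verified Lean document; each statement's English description precedes it below -/
import Mathlib

section
/- For every ε > 0 there exists a constant C_ε such that the following holds. Let β₁, β₂ be positive integers with gcd(β₂, 2β₁) = 1, and let Z ≥ 1 be real. Then | Σ_{α ≥ 1, α ≤ Z, gcd(α, 2β₁)=1} φ(α·β₂)/(α²·β₂) − Π_{β₁,β₂}(1)·(Σ_{β₁,β₂}(1) + γ + log Z) | ≤ C_ε · Π̃_{β₁}(1/2) · Z^{ε − 1/2}, where Π_{β₁,β₂}(1) := (6/π²)·∏_{p prime, p∣2β₁β₂} (1 + 1/p)^{−1}, Σ_{β₁,β₂}(1) := Σ_{p prime, p∣2β₁} (log p)/(p−1) + Σ_{p prime, p∤2β₁β₂} (log p)/(p²−1), γ is the Euler–Mascheroni constant, and Π̃_{β₁}(1/2) := ∏_{p prime, p∣2β₁} (1 + p^{−1/2}). -/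
open Finset

/-- The function supported on squarefree integers that sends a squarefree `n` to
`∏ p ∈ n.primeFactors, t p`. -/
noncomputable def squarefreeProd (t : ℕ → ℝ) (n : ℕ) : ℝ :=
  if Squarefree n then ∏ p ∈ n.primeFactors, t p else 0

namespace squarefreeProd

variable {t : ℕ → ℝ}

lemma apply_of_squarefree {n : ℕ} (hn : Squarefree n) :
    squarefreeProd t n = ∏ p ∈ n.primeFactors, t p := if_pos hn

lemma apply_of_not_squarefree {n : ℕ} (hn : ¬ Squarefree n) : squarefreeProd t n = 0 := if_neg hn

@[simp] lemma apply_zero : squarefreeProd t 0 = 0 := by simp [squarefreeProd]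

@[simp] lemma apply_one : squarefreeProd t 1 = 1 := by simp [squarefreeProd]

lemma apply_prime {p : ℕ} (hp : p.Prime) : squarefreeProd t p = t p := by
  rw [apply_of_squarefree hp.prime.squarefree, hp.primeFactors, prod_singleton]

lemma apply_mul {m n : ℕ} (h : m.Coprime n) :
    squarefreeProd t (m * n) = squarefreeProd t m * squarefreeProd t n := by
  simp only [squarefreeProd, Nat.squarefree_mul h, h.primeFactors_mul,
    prod_union h.disjoint_primeFactors]
  split_ifs <;> simp_all

lemma nonneg (ht : ∀ p : ℕ, p.Prime → 0 ≤ t p) (n : ℕ) : 0 ≤ squarefreeProd t n := by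
  unfold squarefreeProd
  split_ifs
  · exact prod_nonneg fun p hp => ht p (Nat.prime_of_mem_primeFactors hp)
  · rfl

lemma abs_apply (n : ℕ) : |squarefreeProd t n| = squarefreeProd (fun p => |t p|) n := by
  unfold squarefreeProd
  split_ifs
  · exact abs_prod _ _
  · exact abs_zero

lemma apply_mul_rpow (s : ℝ) (n : ℕ) :
    squarefreeProd (fun p => t p * (p : ℝ) ^ s) n = squarefreeProd t n * (n : ℝ) ^ s := by
  unfold squarefreeProd
  split_ifs with h
  · rw [prod_mul_distrib, Real.finsetProd_rpow _ _ fun p _ => p.cast_nonneg, ← Nat.cast_prod,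
      Nat.prod_primeFactors_of_squarefree h]
  · simp

lemma apply_div (n : ℕ) :
    squarefreeProd (fun p => t p / p) n = squarefreeProd t n / n := by
  simpa [div_eq_mul_inv, Real.rpow_neg_one] using apply_mul_rpow (t := t) (-1) n

lemma sum_divisors {n : ℕ} (hn : n ≠ 0) :
    ∑ d ∈ n.divisors, squarefreeProd t d = ∏ p ∈ n.primeFactors, (1 + t p) := by
  simp only [squarefreeProd]
  rw [prod_one_add, ← sum_filter]
  refine sum_nbij' Nat.primeFactors (fun s => ∏ p ∈ s, p) ?_ ?_ ?_ ?_ ?_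
  · intro d hd
    rw [mem_filter, Nat.mem_divisors] at hd
    exact mem_powerset.2 (Nat.primeFactors_mono hd.1.1 hn)
  · intro s hs
    rw [mem_powerset] at hs
    have hs' : ∀ p ∈ s, p.Prime := fun p hp => Nat.prime_of_mem_primeFactors (hs hp)
    rw [mem_filter, Nat.mem_divisors]
    refine ⟨⟨(prod_dvd_prod_of_subset _ _ _ hs).trans n.prod_primeFactors_dvd, hn⟩, ?_⟩
    rw [Nat.squarefree_iff_prime_squarefree]
    intro p hp h
    have h0 : ∏ q ∈ s, q ≠ 0 := prod_ne_zero_iff.2 fun q hq => (hs' q hq).ne_zero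
    have hps : p ∈ s := by
      rw [← Nat.primeFactors_prod hs', Nat.mem_primeFactors_of_ne_zero h0]
      exact ⟨hp, (dvd_mul_right p p).trans h⟩
    rw [← mul_prod_erase s _ hps] at h
    have h1 := Nat.dvd_of_mul_dvd_mul_left hp.pos h
    obtain ⟨q, hq, hpq⟩ := (hp.prime.dvd_finsetProd_iff _).1 h1
    rw [mem_erase] at hq
    exact hq.1 ((Nat.prime_dvd_prime_iff_eq hp (hs' q hq.2)).1 hpq).symm
  · intro d hd
    exact Nat.prod_primeFactors_of_squarefree (mem_filter.1 hd).2
  · intro s hs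
    exact Nat.primeFactors_prod fun p hp => Nat.prime_of_mem_primeFactors (mem_powerset.1 hs hp)
  · intro d hd
    rfl

lemma sum_le_of_le {b : ℕ → ℝ} {s : Finset ℕ} (ht : ∀ p : ℕ, p.Prime → 0 ≤ t p)
    (hs : ∀ p ∈ s, p.Prime) (hb : Summable b) (hb0 : ∀ p, 0 ≤ b p)
    (htb : ∀ p : ℕ, p.Prime → p ∉ s → t p ≤ b p) (u : Finset ℕ) :
    ∑ n ∈ u, squarefreeProd t n ≤ (∏ p ∈ s, (1 + t p)) * Real.exp (∑' p, b p) := by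
  set M := ∏ d ∈ u.erase 0, d with hM
  have hM0 : M ≠ 0 := prod_ne_zero_iff.2 fun d hd => (mem_erase.1 hd).1
  have h1 : ∑ n ∈ u, squarefreeProd t n ≤ ∑ d ∈ M.divisors, squarefreeProd t d := by
    rw [← sum_erase u apply_zero]
    refine sum_le_sum_of_subset_of_nonneg (fun d hd => ?_) fun d _ _ => nonneg ht d
    exact Nat.mem_divisors.2 ⟨dvd_prod_of_mem _ hd, hM0⟩
  rw [sum_divisors hM0, ← prod_filter_mul_prod_filter_not M.primeFactors (· ∈ s)] at h1
  refine h1.trans (mul_le_mul ?_ ?_ ?_ ?_)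
  · have hsub : M.primeFactors.filter (· ∈ s) ⊆ s := fun p hp => (mem_filter.1 hp).2
    rw [← prod_sdiff hsub]
    refine le_mul_of_one_le_left (prod_nonneg fun p hp => ?_) (one_le_prod fun p hp => ?_)
    · linarith [ht p (hs p (hsub hp))]
    · linarith [ht p (hs p (mem_sdiff.1 hp).1)]
  · calc ∏ p ∈ M.primeFactors with p ∉ s, (1 + t p)
        ≤ Real.exp (∑ p ∈ M.primeFactors with p ∉ s, t p) :=
          by
            rw [Real.exp_sum]
            refine prod_le_prod (fun p hp => ?_) fun p _ => ?_
            · linarith [ht p (Nat.prime_of_mem_primeFactors (mem_filter.1 hp).1)]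
            · linarith [Real.add_one_le_exp (t p)]
      _ ≤ Real.exp (∑' p, b p) := by
          gcongr
          refine (sum_le_sum fun p hp => ?_).trans (hb.sum_le_tsum _ fun p _ => hb0 p)
          rw [mem_filter] at hp
          exact htb p (Nat.prime_of_mem_primeFactors hp.1) hp.2
  · refine prod_nonneg fun p hp => ?_
    linarith [ht p (Nat.prime_of_mem_primeFactors (mem_filter.1 hp).1)]
  · refine prod_nonneg fun p hp => ?_
    linarith [ht p (hs p hp)]

lemma hasProd (ht : Summable (squarefreeProd t)) :
    HasProd (Set.mulIndicator {p | Nat.Prime p} fun p => 1 + t p) (∑' n, squarefreeProd t n) := by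
  convert! EulerProduct.eulerProduct_hasProd_mulIndicator apply_one (fun h => apply_mul h) ht.norm
    apply_zero using 1
  refine Set.mulIndicator_congr fun p hp => ?_
  rw [tsum_eq_sum (s := range 2), sum_range_succ, sum_range_one, pow_zero, pow_one, apply_one,
    apply_prime hp]
  intro e he
  rw [mem_range, not_lt] at he
  refine apply_of_not_squarefree fun h => ?_
  have := (Nat.squarefree_pow_iff (Nat.Prime.ne_one hp) (by omega)).1 h
  omega

lemma tsum_dvd (ht : Summable (squarefreeProd t)) {p : ℕ} (hp : p.Prime) (htp : 1 + t p ≠ 0) :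
    ∑' n, (if p ∣ n then squarefreeProd t n else 0) =
      t p / (1 + t p) * ∑' n, squarefreeProd t n := by
  have hA : Summable fun n => if p ∣ n then squarefreeProd t n else 0 :=
    (ht.indicator {n | p ∣ n}).congr fun n => by simp [Set.indicator_apply]
  have hB : Summable fun n => if p ∣ n then 0 else squarefreeProd t n := by
    refine (ht.sub hA).congr fun n => ?_
    split_ifs <;> simp
  have hsplit : ∑' n, squarefreeProd t n = (∑' n, if p ∣ n then squarefreeProd t n else 0) +
      ∑' n, if p ∣ n then 0 else squarefreeProd t n := by
    rw [← hA.tsum_add hB]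
    refine tsum_congr fun n => ?_
    split_ifs <;> simp
  have hmul : (∑' n, if p ∣ n then squarefreeProd t n else 0) =
      t p * ∑' n, if p ∣ n then 0 else squarefreeProd t n := by
    rw [← tsum_mul_left, ← (mul_right_injective₀ hp.ne_zero).tsum_eq]
    · refine tsum_congr fun n => ?_
      rw [if_pos (dvd_mul_right p n)]
      split_ifs with h
      · rw [mul_zero]
        refine apply_of_not_squarefree fun hsq => hp.one_lt.ne' (Nat.isUnit_iff.1 (hsq p ?_))
        exact mul_dvd_mul_left p h
      · rw [apply_mul ((Nat.Prime.coprime_iff_not_dvd hp).2 h), apply_prime hp]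
    · intro n hn
      rw [Function.mem_support, ne_eq, ite_eq_right_iff, not_forall] at hn
      obtain ⟨k, rfl⟩ := hn.1
      exact ⟨k, rfl⟩
  rw [div_mul_eq_mul_div, eq_div_iff htp, hsplit]
  linear_combination hmul

lemma sum_log_primeFactors {n : ℕ} (hn : Squarefree n) :
    ∑ p ∈ n.primeFactors, Real.log p = Real.log n := by
  rw [← Real.log_prod fun p hp => Nat.cast_ne_zero.2 (Nat.prime_of_mem_primeFactors hp).ne_zero,
    ← Nat.cast_prod, Nat.prod_primeFactors_of_squarefree hn]

/-- The logarithmic derivative of the Euler product of `squarefreeProd t`. -/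
lemma hasSum_log_mul (ht : Summable (squarefreeProd t))
    (hlog : Summable fun n : ℕ => squarefreeProd t n * Real.log n)
    (htp : ∀ p : ℕ, p.Prime → 1 + t p ≠ 0) :
    HasSum (fun p : ℕ => if p.Prime then
        Real.log p * (t p / (1 + t p)) * ∑' n, squarefreeProd t n else 0)
      (∑' n : ℕ, squarefreeProd t n * Real.log n) := by
  let F : ℕ × ℕ → ℝ := fun x =>
    if x.2 ∈ x.1.primeFactors then squarefreeProd t x.1 * Real.log x.2 else 0
  have hsum (n : ℕ) : ∑ p ∈ n.primeFactors, F (n, p) = squarefreeProd t n * Real.log n := by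
    rw [sum_congr rfl fun p hp => show F (n, p) = squarefreeProd t n * Real.log p from if_pos hp,
      ← mul_sum]
    by_cases hn : Squarefree n
    · rw [sum_log_primeFactors hn]
    · simp [apply_of_not_squarefree hn]
  have hsum_abs (n : ℕ) :
      ∑ p ∈ n.primeFactors, |F (n, p)| = |squarefreeProd t n * Real.log n| := by
    rw [sum_congr rfl fun p hp =>
        show |F (n, p)| = |squarefreeProd t n| * Real.log p from ?_,
      ← mul_sum, abs_mul, abs_of_nonneg (Real.log_natCast_nonneg n)]
    · by_cases hn : Squarefree n
      · rw [sum_log_primeFactors hn]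
      · simp [apply_of_not_squarefree hn]
    · rw [show F (n, p) = squarefreeProd t n * Real.log p from if_pos hp, abs_mul,
        abs_of_nonneg (Real.log_natCast_nonneg p)]
  have hfin (n : ℕ) : HasSum (fun p => F (n, p)) (squarefreeProd t n * Real.log n) := by
    rw [← hsum]
    exact hasSum_sum_of_ne_finset_zero fun p hp => if_neg hp
  have habs (n : ℕ) : HasSum (fun p => |F (n, p)|) |squarefreeProd t n * Real.log n| := by
    rw [← hsum_abs]
    exact hasSum_sum_of_ne_finset_zero fun p hp => abs_eq_zero.2 (if_neg hp)
  have hF : Summable F := by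
    refine Summable.of_abs ((summable_prod_of_nonneg fun x => abs_nonneg _).2
      ⟨fun n => (habs n).summable, ?_⟩)
    simpa only [(habs _).tsum_eq] using hlog.abs
  have htot : HasSum F (∑' n : ℕ, squarefreeProd t n * Real.log n) := by
    rw [hF.hasSum_iff, hF.tsum_prod]
    exact tsum_congr fun n => (hfin n).tsum_eq
  have hswap := (Equiv.prodComm ℕ ℕ).hasSum_iff.2 htot
  refine hswap.prod_fiberwise fun p => ?_
  have hfib := ((hF.comp_injective (Equiv.prodComm ℕ ℕ).injective).prod_factor p).hasSum
  convert! hfib using 1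
  by_cases hp : p.Prime
  · rw [if_pos hp, mul_assoc, ← tsum_dvd ht hp (htp p hp), ← tsum_mul_left]
    refine tsum_congr fun n => ?_
    rcases eq_or_ne n 0 with rfl | hn
    · simp [F]
    · simp [F, hp, hn, mul_comm]
  · simp [F, hp]

end squarefreeProd

lemma abs_harmonic_floor_sub_log_sub_eulerMascheroniConstant_le {x : ℝ} (hx : 0 < x) :
    |(harmonic ⌊x⌋₊ : ℝ) - Real.log x - Real.eulerMascheroniConstant| ≤
      2 * x ^ (-(1 : ℝ) / 2) := by
  rcases lt_or_ge x 1 with h1 | h1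
  · have hlog := Real.log_le_sub_one_of_pos (Real.rpow_pos_of_pos hx (-(1 : ℝ) / 2))
    rw [Real.log_rpow hx] at hlog
    have hneg := Real.log_neg hx h1
    have hγ := Real.eulerMascheroniConstant_lt_two_thirds
    have hγ' := Real.one_half_lt_eulerMascheroniConstant
    rw [Nat.floor_eq_zero.2 h1, harmonic_zero, Rat.cast_zero, abs_le]
    constructor <;> linarith
  · set n := ⌊x⌋₊ with hn
    have hn0 : n ≠ 0 := (Nat.floor_pos.2 h1).ne'
    have hn1 : (1 : ℝ) ≤ n := by exact_mod_cast Nat.one_le_iff_ne_zero.2 hn0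
    have hnx : (n : ℝ) ≤ x := Nat.floor_le hx.le
    have hxn : x < n + 1 := Nat.lt_floor_add_one x
    have hlow := Real.eulerMascheroniSeq_lt_eulerMascheroniConstant n
    have hupp := Real.eulerMascheroniConstant_lt_eulerMascheroniSeq' n
    rw [Real.eulerMascheroniSeq] at hlow
    rw [Real.eulerMascheroniSeq', if_neg hn0] at hupp
    have hl1 : Real.log n ≤ Real.log x := Real.log_le_log (by linarith) hnx
    have hl2 : Real.log x ≤ Real.log (n + 1) := Real.log_le_log hx hxn.le
    have hl3 : Real.log (n + 1) - Real.log n ≤ 2 * x⁻¹ := by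
      rw [← Real.log_div (by positivity) (by positivity)]
      refine (Real.log_le_sub_one_of_pos (by positivity)).trans ?_
      rw [← div_eq_mul_inv, le_div_iff₀ hx, div_sub_one (by positivity), add_sub_cancel_left,
        one_div_mul_eq_div, div_le_iff₀ (by positivity)]
      linarith
    have hl4 : x⁻¹ ≤ x ^ (-(1 : ℝ) / 2) := by
      rw [← Real.rpow_neg_one]
      exact Real.rpow_le_rpow_of_exponent_le h1 (by norm_num)
    rw [abs_le]
    constructor <;> linarith

lemma sum_Ioc_sum_divisors_div (h : ℕ → ℝ) (N : ℕ) :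
    ∑ n ∈ Ioc 0 N, (∑ d ∈ n.divisors, h d) / n =
      ∑ d ∈ Ioc 0 N, h d / d * (harmonic (N / d) : ℝ) := by
  let f : ArithmeticFunction ℝ := ⟨fun n => h n / n, by simp⟩
  let g : ArithmeticFunction ℝ := ⟨fun n => (n : ℝ)⁻¹, by simp⟩
  have key := ArithmeticFunction.sum_Ioc_mul_eq_sum_sum f g N
  have hl : ∀ n ∈ Ioc 0 N, (∑ d ∈ n.divisors, h d) / n = (f * g) n := by
    intro n _
    rw [ArithmeticFunction.mul_apply, Nat.sum_divisorsAntidiagonal fun a b => f a * g b, sum_div]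
    refine sum_congr rfl fun d hd => ?_
    have hd0 : (d : ℝ) ≠ 0 := Nat.cast_ne_zero.2 (Nat.pos_of_mem_divisors hd).ne'
    simp only [f, g, ArithmeticFunction.coe_mk]
    rw [Nat.cast_div (Nat.dvd_of_mem_divisors hd) hd0, inv_div, div_mul_div_cancel₀ hd0]
  rw [sum_congr rfl hl, key]
  refine sum_congr rfl fun d _ => ?_
  simp only [f, g, ArithmeticFunction.coe_mk, harmonic_eq_sum_Icc, Rat.cast_sum, Rat.cast_inv,
    Rat.cast_natCast]
  rfl

namespace squarefreeProd

variable {t : ℕ → ℝ}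

lemma abs_div_eq (n : ℕ) :
    |squarefreeProd (fun p => t p / p) n| = |squarefreeProd t n| / n := by
  rw [apply_div, abs_div, Nat.abs_cast]

lemma abs_mul_rpow_eq (s : ℝ) (n : ℕ) :
    squarefreeProd (fun p => |t p| * (p : ℝ) ^ s) n = |squarefreeProd t n| * (n : ℝ) ^ s := by
  rw [apply_mul_rpow, abs_apply]

lemma inv_le_rpow_neg_half (n : ℕ) : (n : ℝ)⁻¹ ≤ (n : ℝ) ^ (-(1 : ℝ) / 2) := by
  rcases Nat.eq_zero_or_pos n with rfl | hn
  · norm_num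
  · rw [← Real.rpow_neg_one]
    exact Real.rpow_le_rpow_of_exponent_le (by exact_mod_cast hn) (by norm_num)

lemma summable_div
    (ht : Summable (squarefreeProd fun p => |t p| * (p : ℝ) ^ (-(1 : ℝ) / 2))) :
    Summable (squarefreeProd fun p => t p / p) := by
  refine Summable.of_norm_bounded ht fun n => ?_
  rw [Real.norm_eq_abs, abs_div_eq, abs_mul_rpow_eq, div_eq_mul_inv]
  gcongr
  exact inv_le_rpow_neg_half n

lemma summable_div_mul_log
    (ht : Summable (squarefreeProd fun p => |t p| * (p : ℝ) ^ (-(1 : ℝ) / 2))) :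
    Summable fun n : ℕ => squarefreeProd (fun p => t p / p) n * Real.log n := by
  refine Summable.of_norm_bounded (ht.mul_left 2) fun n => ?_
  rw [Real.norm_eq_abs, abs_mul, abs_div_eq, abs_mul_rpow_eq,
    abs_of_nonneg (Real.log_natCast_nonneg n)]
  rcases Nat.eq_zero_or_pos n with rfl | hn
  · simp
  have hn' : (0 : ℝ) < n := by exact_mod_cast hn
  have hlog := Real.log_le_rpow_div hn'.le (ε := 1 / 2) (by norm_num)
  calc |squarefreeProd t n| / n * Real.log n
      ≤ |squarefreeProd t n| / n * ((n : ℝ) ^ (1 / 2 : ℝ) / (1 / 2)) := by gcongr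
    _ = 2 * (|squarefreeProd t n| * ((n : ℝ) ^ (1 / 2 : ℝ) / n)) := by ring
    _ = 2 * (|squarefreeProd t n| * (n : ℝ) ^ (-(1 : ℝ) / 2)) := by
        rw [← Real.rpow_sub_one hn'.ne']
        norm_num

lemma abs_sum_prod_primeFactors_div_sub_le
    (ht : Summable (squarefreeProd fun p => |t p| * (p : ℝ) ^ (-(1 : ℝ) / 2)))
    {Z : ℝ} (hZ : 0 < Z) :
    |(∑ n ∈ Ioc 0 ⌊Z⌋₊, (∏ p ∈ n.primeFactors, (1 + t p)) / n) -
        ((∑' n, squarefreeProd (fun p => t p / p) n) *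
            (Real.log Z + Real.eulerMascheroniConstant) -
          ∑' n : ℕ, squarefreeProd (fun p => t p / p) n * Real.log n)| ≤
      2 * Z ^ (-(1 : ℝ) / 2) *
        ∑' n, squarefreeProd (fun p => |t p| * (p : ℝ) ^ (-(1 : ℝ) / 2)) n := by
  set g := squarefreeProd fun p => t p / p with hg
  have hsum : ∑ n ∈ Ioc 0 ⌊Z⌋₊, (∏ p ∈ n.primeFactors, (1 + t p)) / n =
      ∑ d ∈ Ioc 0 ⌊Z⌋₊, g d * (harmonic (⌊Z⌋₊ / d) : ℝ) := by
    simp only [hg, apply_div]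
    rw [← sum_Ioc_sum_divisors_div]
    refine sum_congr rfl fun n hn => ?_
    rw [sum_divisors (mem_Ioc.1 hn).1.ne']
  have hS : HasSum (fun d => g d * (harmonic (⌊Z⌋₊ / d) : ℝ))
      (∑ d ∈ Ioc 0 ⌊Z⌋₊, g d * (harmonic (⌊Z⌋₊ / d) : ℝ)) := by
    refine hasSum_sum_of_ne_finset_zero fun d hd => ?_
    rcases Nat.eq_zero_or_pos d with rfl | hd0
    · simp [hg]
    · rw [mem_Ioc, not_and, not_le] at hd
      rw [Nat.div_eq_of_lt (hd hd0), harmonic_zero, Rat.cast_zero, mul_zero]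
  have hE := hS.sub (((summable_div ht).hasSum.mul_right
    (Real.log Z + Real.eulerMascheroniConstant)).sub (summable_div_mul_log ht).hasSum)
  rw [hsum, ← Real.norm_eq_abs]
  refine hE.norm_le_of_bounded (ht.hasSum.mul_left _) fun d => ?_
  rcases Nat.eq_zero_or_pos d with rfl | hd
  · simp [hg]
  have hd' : (0 : ℝ) < d := by exact_mod_cast hd
  have hbound := abs_harmonic_floor_sub_log_sub_eulerMascheroniConstant_le (div_pos hZ hd')
  rw [Nat.floor_div_natCast, Real.log_div hZ.ne' hd'.ne', Real.div_rpow hZ.le hd'.le] at hbound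
  calc ‖g d * (harmonic (⌊Z⌋₊ / d) : ℝ) - (g d * (Real.log Z + Real.eulerMascheroniConstant) -
          g d * Real.log d)‖
      = |g d| * |(harmonic (⌊Z⌋₊ / d) : ℝ) - (Real.log Z - Real.log d) -
          Real.eulerMascheroniConstant| := by
        rw [Real.norm_eq_abs, ← abs_mul]
        ring_nf
    _ ≤ |g d| * (2 * (Z ^ (-(1 : ℝ) / 2) / (d : ℝ) ^ (-(1 : ℝ) / 2))) := by gcongr
    _ = 2 * Z ^ (-(1 : ℝ) / 2) * (|squarefreeProd t d| *
          ((d : ℝ) * (d : ℝ) ^ (-(1 : ℝ) / 2))⁻¹) := by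
        rw [hg, abs_div_eq]
        field_simp
    _ = _ := by
        rw [abs_mul_rpow_eq, ← Real.rpow_one_add' hd'.le (by norm_num), ← Real.rpow_neg hd'.le]
        norm_num

end squarefreeProd

lemma hasProd_inv_one_sub_inv_sq :
    HasProd (Set.mulIndicator {p | Nat.Prime p} fun p : ℕ => (1 - ((p : ℝ) ^ 2)⁻¹)⁻¹)
      (Real.pi ^ 2 / 6) := by
  have hs := hasSum_zeta_two
  rw [← hs.tsum_eq]
  convert! EulerProduct.eulerProduct_hasProd_mulIndicator (f := fun n : ℕ => (1 : ℝ) / (n : ℝ) ^ 2)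
    (by simp) (fun {m n} _ => by push_cast; ring) hs.summable.norm (by simp) using 1
  refine Set.mulIndicator_congr fun p hp => ?_
  have hp2 : (2 : ℝ) ≤ p := by exact_mod_cast Nat.Prime.two_le hp
  rw [← tsum_geometric_of_lt_one (by positivity) (inv_lt_one_of_one_lt₀ (by nlinarith))]
  refine tsum_congr fun e => ?_
  rw [Nat.cast_pow, one_div, inv_pow, ← pow_mul, ← pow_mul, mul_comm]

/-- The values at primes of `μ * f`, where `f n = φ(nb) / (nφ(b))` if `n` is coprime to `m`, and
`f n = 0` otherwise. -/
noncomputable def totientTwist (m b p : ℕ) : ℝ :=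
  if p ∣ m then -1 else if p ∣ b then 0 else -(p : ℝ)⁻¹

namespace totientTwist

variable {m b : ℕ}

lemma abs_le (p : ℕ) : |totientTwist m b p| ≤ 1 := by
  unfold totientTwist
  split_ifs
  · simp
  · simp
  · simpa using Nat.cast_inv_le_one p

lemma one_add_div_pos {p : ℕ} (hp : p.Prime) : 0 < 1 + totientTwist m b p / p := by
  have hp2 : (2 : ℝ) ≤ p := by exact_mod_cast hp.two_le
  have h := (_root_.abs_le.1 (abs_le (m := m) (b := b) p)).1
  have : -1 < totientTwist m b p / p := by
    rw [lt_div_iff₀ (by linarith)]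
    linarith
  linarith

lemma sum_squarefreeProd_le (hm : m ≠ 0) (u : Finset ℕ) :
    ∑ n ∈ u, squarefreeProd (fun p => |totientTwist m b p| * (p : ℝ) ^ (-(1 : ℝ) / 2)) n ≤
      (∏ p ∈ m.primeFactors, (1 + (p : ℝ) ^ (-(1 : ℝ) / 2))) *
        Real.exp (∑' n : ℕ, (n : ℝ) ^ (-(3 : ℝ) / 2)) := by
  refine (squarefreeProd.sum_le_of_le (s := m.primeFactors) (fun p _ => by positivity)
    (fun p hp => Nat.prime_of_mem_primeFactors hp)
    (Real.summable_nat_rpow (p := -(3 : ℝ) / 2).2 (by norm_num)) (fun p => by positivity)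
    (fun p hp hpm => ?_) u).trans_eq ?_
  · have hpm' : ¬ p ∣ m := fun h => hpm (Nat.mem_primeFactors.2 ⟨hp, h, hm⟩)
    have hp0 : (0 : ℝ) < p := by exact_mod_cast hp.pos
    have h1 : |totientTwist m b p| ≤ (p : ℝ)⁻¹ := by
      rw [totientTwist, if_neg hpm']
      split_ifs <;> simp
    calc |totientTwist m b p| * (p : ℝ) ^ (-(1 : ℝ) / 2)
        ≤ (p : ℝ)⁻¹ * (p : ℝ) ^ (-(1 : ℝ) / 2) := by gcongr
      _ = (p : ℝ) ^ (-(3 : ℝ) / 2) := by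
        rw [← Real.rpow_neg_one, ← Real.rpow_add hp0]
        norm_num
  · congr 1
    refine prod_congr rfl fun p hp => ?_
    rw [totientTwist, if_pos (Nat.dvd_of_mem_primeFactors hp), abs_neg, abs_one, one_mul]

lemma summable (hm : m ≠ 0) :
    Summable (squarefreeProd fun p => |totientTwist m b p| * (p : ℝ) ^ (-(1 : ℝ) / 2)) :=
  summable_of_sum_le (squarefreeProd.nonneg fun p _ => by positivity) (sum_squarefreeProd_le hm)

lemma tsum_le (hm : m ≠ 0) :
    ∑' n, squarefreeProd (fun p => |totientTwist m b p| * (p : ℝ) ^ (-(1 : ℝ) / 2)) n ≤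
      (∏ p ∈ m.primeFactors, (1 + (p : ℝ) ^ (-(1 : ℝ) / 2))) *
        Real.exp (∑' n : ℕ, (n : ℝ) ^ (-(3 : ℝ) / 2)) :=
  (summable hm).tsum_le_of_sum_le (sum_squarefreeProd_le hm)

lemma totient_div_eq_prod {n : ℕ} (hn : n ≠ 0) :
    (n.totient : ℝ) / n = ∏ p ∈ n.primeFactors, (1 - (p : ℝ)⁻¹) := by
  rw [div_eq_iff (Nat.cast_ne_zero.2 hn), mul_comm]
  have h := congrArg (Rat.cast : ℚ → ℝ) (Nat.totient_eq_mul_prod_factors n)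
  push_cast at h
  exact h

lemma totient_mul_div_eq {n : ℕ} (hn : n ≠ 0) (hb : b ≠ 0) :
    (if n.Coprime m then ((n * b).totient : ℝ) / ((n : ℝ) ^ 2 * b) else 0) =
      b.totient / b * ((∏ p ∈ n.primeFactors, (1 + totientTwist m b p)) / n) := by
  split_ifs with h
  · have hn' : (n : ℝ) ≠ 0 := Nat.cast_ne_zero.2 hn
    have hb' : (b : ℝ) ≠ 0 := Nat.cast_ne_zero.2 hb
    have hpm : ∀ p ∈ n.primeFactors, ¬ p ∣ m := fun p hp hpm =>
      (Nat.prime_of_mem_primeFactors hp).one_lt.ne'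
        (Nat.eq_one_of_dvd_coprimes h (Nat.dvd_of_mem_primeFactors hp) hpm)
    have hprod : ∏ p ∈ n.primeFactors, (1 + totientTwist m b p) =
        ∏ p ∈ n.primeFactors \ b.primeFactors, (1 - (p : ℝ)⁻¹) := by
      rw [← prod_subset sdiff_subset fun p hp hpb => ?_]
      · refine prod_congr rfl fun p hp => ?_
        obtain ⟨hpn, hpb⟩ := mem_sdiff.1 hp
        have hpb' : ¬ p ∣ b := fun h =>
          hpb (Nat.mem_primeFactors.2 ⟨Nat.prime_of_mem_primeFactors hpn, h, hb⟩)
        rw [totientTwist, if_neg (hpm p hpn), if_neg hpb', ← sub_eq_add_neg]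
      · have hpb' : p ∈ b.primeFactors := by
          by_contra h
          exact hpb (mem_sdiff.2 ⟨hp, h⟩)
        rw [totientTwist, if_neg (hpm p hp), if_pos (Nat.dvd_of_mem_primeFactors hpb'), add_zero]
    have hsplit : ((n * b).totient : ℝ) / (n * b : ℕ) = b.totient / b *
        ∏ p ∈ n.primeFactors, (1 + totientTwist m b p) := by
      rw [totient_div_eq_prod (mul_ne_zero hn hb), totient_div_eq_prod hb, hprod,
        Nat.primeFactors_mul hn hb, union_comm, ← union_sdiff_self_eq_union,
        prod_union disjoint_sdiff]
    rw [← mul_div_assoc, ← hsplit]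
    push_cast
    field_simp
  · rw [Nat.Prime.not_coprime_iff_dvd] at h
    obtain ⟨p, hp, hpn, hpm⟩ := h
    rw [prod_eq_zero (Nat.mem_primeFactors.2 ⟨hp, hpn, hn⟩), zero_div, mul_zero]
    rw [totientTwist, if_pos hpm, add_neg_cancel]

lemma totient_div_mul_tsum (hm : m ≠ 0) (hb : b ≠ 0) (hbm : b.Coprime m) :
    (b.totient : ℝ) / b * ∑' n, squarefreeProd (fun p => totientTwist m b p / p) n =
      6 / Real.pi ^ 2 * ∏ p ∈ (m * b).primeFactors, (1 + 1 / (p : ℝ))⁻¹ := by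
  have hmb : m * b ≠ 0 := mul_ne_zero hm hb
  have hprod := hasProd_inv_one_sub_inv_sq.mul
    (squarefreeProd.hasProd (squarefreeProd.summable_div (summable (b := b) hm)))
  have hfin := hasProd_prod_of_ne_finset_one (s := (m * b).primeFactors)
    (f := fun p => Set.mulIndicator {p | Nat.Prime p} (fun p : ℕ => (1 - ((p : ℝ) ^ 2)⁻¹)⁻¹) p *
      Set.mulIndicator {p | Nat.Prime p} (fun p : ℕ => 1 + totientTwist m b p / p) p)
    (L := SummationFilter.unconditional ℕ) ?_
  · have heq := hprod.unique hfin
    have hc : (b.totient : ℝ) / b =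
        ∏ p ∈ (m * b).primeFactors, if p ∣ b then 1 - (p : ℝ)⁻¹ else 1 := by
      rw [totient_div_eq_prod hb, ← prod_filter]
      refine prod_congr ?_ fun _ _ => rfl
      ext p
      simp only [mem_filter, Nat.mem_primeFactors]
      exact ⟨fun h => ⟨⟨h.1, h.2.1.mul_left m, hmb⟩, h.2.1⟩, fun h => ⟨h.1.1, h.2, hb⟩⟩
    have hterm : (b.totient : ℝ) / b * (Real.pi ^ 2 / 6 *
        ∑' n, squarefreeProd (fun p => totientTwist m b p / p) n) =
        ∏ p ∈ (m * b).primeFactors, (1 + 1 / (p : ℝ))⁻¹ := by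
      rw [heq, hc, ← prod_mul_distrib]
      refine prod_congr rfl fun p hp => ?_
      obtain ⟨hpp, hpmb, -⟩ := Nat.mem_primeFactors.1 hp
      have hp2 : (2 : ℝ) ≤ p := by exact_mod_cast hpp.two_le
      have hp0 : (p : ℝ) ≠ 0 := by positivity
      have h1 : (p : ℝ) - 1 ≠ 0 := by linarith
      have h2 : (p : ℝ) + 1 ≠ 0 := by linarith
      have h3 : 1 - ((p : ℝ) ^ 2)⁻¹ = (p - 1) * (p + 1) / p ^ 2 := by
        field_simp
        ring
      rw [Set.mulIndicator_of_mem (show p ∈ {p | Nat.Prime p} from hpp),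
        Set.mulIndicator_of_mem (show p ∈ {p | Nat.Prime p} from hpp), h3, totientTwist]
      by_cases hpm : p ∣ m
      · have hpb : ¬ p ∣ b := fun h => hpp.one_lt.ne' (Nat.eq_one_of_dvd_coprimes hbm h hpm)
        rw [if_pos hpm, if_neg hpb]
        field_simp
        ring
      · have hpb : p ∣ b := (hpp.dvd_mul.1 hpmb).resolve_left hpm
        rw [if_neg hpm, if_pos hpb, if_pos hpb]
        field_simp
        ring
    rw [← hterm]
    field_simp
  · intro p hp
    by_cases hpp : p.Prime
    · have hpm : ¬ p ∣ m * b := fun h => hp (Nat.mem_primeFactors.2 ⟨hpp, h, hmb⟩)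
      have hp2 : (2 : ℝ) ≤ p := by exact_mod_cast hpp.two_le
      rw [Set.mulIndicator_of_mem (show p ∈ {p | Nat.Prime p} from hpp),
        Set.mulIndicator_of_mem (show p ∈ {p | Nat.Prime p} from hpp), totientTwist,
        if_neg fun h => hpm (h.mul_right b), if_neg fun h => hpm (h.mul_left m), neg_div,
        ← sub_eq_add_neg, div_eq_mul_inv, ← mul_inv, ← sq]
      refine inv_mul_cancel₀ (sub_pos.2 (inv_lt_one_of_one_lt₀ (by nlinarith))).ne'
    · rw [Set.mulIndicator_of_notMem (show p ∉ {p | Nat.Prime p} from hpp),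
        Set.mulIndicator_of_notMem (show p ∉ {p | Nat.Prime p} from hpp), one_mul]

lemma tsum_mul_log (hm : m ≠ 0) :
    ∑' n : ℕ, squarefreeProd (fun p => totientTwist m b p / p) n * Real.log n =
      -(((∑ p ∈ m.primeFactors, Real.log p / ((p : ℝ) - 1)) +
        ∑' p : ℕ, if p.Prime ∧ ¬ p ∣ m * b then Real.log p / ((p : ℝ) ^ 2 - 1) else 0) *
          ∑' n, squarefreeProd (fun p => totientTwist m b p / p) n) := by
  have hs := summable (b := b) hm
  have hlog := squarefreeProd.hasSum_log_mul (squarefreeProd.summable_div hs)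
    (squarefreeProd.summable_div_mul_log hs) fun p hp => (one_add_div_pos hp).ne'
  set G := ∑' n, squarefreeProd (fun p => totientTwist m b p / p) n
  have hfin := hasSum_sum_of_ne_finset_zero (s := m.primeFactors)
    (f := fun p : ℕ => if p ∈ m.primeFactors then Real.log p / ((p : ℝ) - 1) * G else 0)
    (L := SummationFilter.unconditional ℕ) fun p hp => if_neg hp
  rw [sum_congr rfl fun p hp => if_pos hp, ← sum_mul] at hfin
  have hrest := (hlog.add hfin).tsum_eq
  have hterm : ∀ p : ℕ, (if p.Prime then Real.log p *
      (totientTwist m b p / p / (1 + totientTwist m b p / p)) * G else 0) +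
      (if p ∈ m.primeFactors then Real.log p / ((p : ℝ) - 1) * G else 0) =
      (if p.Prime ∧ ¬ p ∣ m * b then Real.log p / ((p : ℝ) ^ 2 - 1) else 0) * -G := by
    intro p
    by_cases hp : p.Prime
    · have hp2 : (2 : ℝ) ≤ p := by exact_mod_cast hp.two_le
      have h1 : (p : ℝ) - 1 ≠ 0 := by linarith
      have h2 : (p : ℝ) + 1 ≠ 0 := by linarith
      have hp0 : (p : ℝ) ≠ 0 := by positivity
      by_cases hpm : p ∣ m
      · have h3 : 1 + -1 / (p : ℝ) = (p - 1) / p := by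
          field_simp
          ring
        simp only [hp, hpm, hm, hpm.mul_right b, totientTwist, Nat.mem_primeFactors, if_true, h3,
          ne_eq, not_false_eq_true, and_self, not_true_eq_false, and_false, if_false]
        field_simp
        ring
      · by_cases hpb : p ∣ b
        · simp [hp, hpm, hpb, hpb.mul_left m, totientTwist]
        · have h3 : 1 + -(p : ℝ)⁻¹ / p = (p - 1) * (p + 1) / p ^ 2 := by
            field_simp
            ring
          have h4 : (p : ℝ) ^ 2 - 1 = (p - 1) * (p + 1) := by ring
          simp only [hp, hpm, hpb, hp.dvd_mul, or_self, totientTwist, Nat.mem_primeFactors,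
            if_true, h3, h4, not_false_eq_true, and_self, false_and, and_false, if_false]
          field_simp
          ring
    · simp [hp]
  rw [tsum_congr hterm, tsum_mul_right] at hrest
  linear_combination -hrest

end totientTwist

/-- Truncated sum `Σ_{α ≤ Z, (α,2β₁)=1} φ(αβ₂)/(α²β₂)` equals
`Π_{β₁,β₂}(1)(Σ_{β₁,β₂}(1) + γ + log Z)` up to an error `≪_ε Π̃_{β₁}(1/2) Z^{ε−1/2}`. -/
theorem truncated_totient_sum (ε : ℝ) (hε : 0 < ε) :
    ∃ Cε > (0 : ℝ), ∀ β₁ β₂ : ℕ, 0 < β₁ → 0 < β₂ → Nat.Coprime β₂ (2 * β₁) →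
      ∀ Z : ℝ, 1 ≤ Z →
      |(∑ α ∈ Finset.Icc 1 ⌊Z⌋₊,
          if Nat.Coprime α (2 * β₁) then
            (Nat.totient (α * β₂) : ℝ) / ((α : ℝ) ^ 2 * β₂) else 0) -
        ((6 / Real.pi ^ 2) * ∏ p ∈ (2 * β₁ * β₂).primeFactors, (1 + 1 / (p : ℝ))⁻¹) *
          ((∑ p ∈ (2 * β₁).primeFactors, Real.log p / ((p : ℝ) - 1)) +
            (∑' p : ℕ, if p.Prime ∧ ¬ p ∣ 2 * β₁ * β₂ then
              Real.log p / ((p : ℝ) ^ 2 - 1) else 0) +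
            Real.eulerMascheroniConstant + Real.log Z)|
      ≤ Cε * (∏ p ∈ (2 * β₁).primeFactors, (1 + ((p : ℝ)) ^ (-(1 : ℝ) / 2))) *
          Z ^ (ε - 1 / 2) := by
  refine ⟨2 * Real.exp (∑' n : ℕ, (n : ℝ) ^ (-(3 : ℝ) / 2)), by positivity, ?_⟩
  intro β₁ β₂ hβ₁ hβ₂ hcop Z hZ
  have hm : 2 * β₁ ≠ 0 := by omega
  have hZ0 : 0 < Z := by linarith
  have hs := totientTwist.summable (b := β₂) hm
  have hmain := squarefreeProd.abs_sum_prod_primeFactors_div_sub_le hs hZ0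
  have hc1 : (β₂.totient : ℝ) / β₂ ≤ 1 :=
    div_le_one_of_le₀ (by exact_mod_cast β₂.totient_le) (by positivity)
  have hexpand : (∑ α ∈ Finset.Icc 1 ⌊Z⌋₊,
      if Nat.Coprime α (2 * β₁) then (Nat.totient (α * β₂) : ℝ) / ((α : ℝ) ^ 2 * β₂) else 0) =
      β₂.totient / β₂ * ∑ n ∈ Ioc 0 ⌊Z⌋₊,
        (∏ p ∈ n.primeFactors, (1 + totientTwist (2 * β₁) β₂ p)) / n := by
    rw [mul_sum]
    exact sum_congr rfl fun n hn =>
      totientTwist.totient_mul_div_eq (mem_Ioc.1 hn).1.ne' hβ₂.ne'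
  rw [totientTwist.tsum_mul_log hm] at hmain
  rw [hexpand, ← totientTwist.totient_div_mul_tsum hm hβ₂.ne' hcop]
  set S := ∑ n ∈ Ioc 0 ⌊Z⌋₊, (∏ p ∈ n.primeFactors, (1 + totientTwist (2 * β₁) β₂ p)) / (n : ℝ)
  set G := ∑' n, squarefreeProd (fun p => totientTwist (2 * β₁) β₂ p / p) n
  set T := ∑' p : ℕ, if p.Prime ∧ ¬ p ∣ 2 * β₁ * β₂ then Real.log p / ((p : ℝ) ^ 2 - 1) else 0
  set A := ∑ p ∈ (2 * β₁).primeFactors, Real.log p / ((p : ℝ) - 1)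
  calc |β₂.totient / β₂ * S -
        β₂.totient / β₂ * G * (A + T + Real.eulerMascheroniConstant + Real.log Z)|
      = β₂.totient / β₂ * |S - (G * (Real.log Z + Real.eulerMascheroniConstant) -
          -((A + T) * G))| := by
        nth_rw 3 [← abs_of_nonneg (show (0 : ℝ) ≤ β₂.totient / β₂ by positivity)]
        rw [← abs_mul]
        ring_nf
    _ ≤ |S - (G * (Real.log Z + Real.eulerMascheroniConstant) - -((A + T) * G))| :=
        mul_le_of_le_one_left (abs_nonneg _) hc1
    _ ≤ 2 * Z ^ (-(1 : ℝ) / 2) * ((∏ p ∈ (2 * β₁).primeFactors, (1 + (p : ℝ) ^ (-(1 : ℝ) / 2))) *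
          Real.exp (∑' n : ℕ, (n : ℝ) ^ (-(3 : ℝ) / 2))) := by
        refine hmain.trans ?_
        gcongr
        exact totientTwist.tsum_le hm
    _ = 2 * Real.exp (∑' n : ℕ, (n : ℝ) ^ (-(3 : ℝ) / 2)) *
          (∏ p ∈ (2 * β₁).primeFactors, (1 + (p : ℝ) ^ (-(1 : ℝ) / 2))) *
          Z ^ (-(1 : ℝ) / 2) := by ring
    _ ≤ _ := by
        gcongr
        linarith
end

section
/- There exists a constant C > 0 such that for every integer n ≥ 3, Σ_{d∣n} (log d)/d ≤ C·(log log n)². -/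
open Finset ArithmeticFunction in
theorem sum_vonMangoldt_div_le (N : ℕ) :
    ∑ m ∈ Ioc 0 N, vonMangoldt m / m ≤ 2 * Real.log N := by
  rcases N.eq_zero_or_pos with rfl | hN
  · simp
  have hN' : (0 : ℝ) < N := by exact_mod_cast hN
  have h : ∑ m ∈ Ioc 0 N, vonMangoldt m * ((N / m : ℕ) : ℝ) ≤ N * Real.log N := by
    rw [← sum_Ioc_mul_zeta_eq_sum, vonMangoldt_mul_zeta]
    refine (sum_le_card_nsmul _ _ (Real.log N) fun n hn => ?_).trans (by simp)
    rw [mem_Ioc] at hn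
    rw [log_apply]
    exact Real.log_le_log (by exact_mod_cast hn.1) (by exact_mod_cast hn.2)
  refine le_of_mul_le_mul_left ?_ hN'
  calc (N : ℝ) * ∑ m ∈ Ioc 0 N, vonMangoldt m / m
      ≤ 2 * ∑ m ∈ Ioc 0 N, vonMangoldt m * ((N / m : ℕ) : ℝ) := by
        rw [mul_sum, mul_sum]
        refine sum_le_sum fun m hm => ?_
        rw [mem_Ioc] at hm
        have hm0 : (0 : ℝ) < m := by exact_mod_cast hm.1
        have hfloor : (N : ℝ) / m / 2 < ((N / m : ℕ) : ℝ) := by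
          rw [← Nat.floor_div_eq_div (K := ℝ)]
          exact Nat.div_two_lt_floor ((one_le_div hm0).2 (by exact_mod_cast hm.2))
        calc (N : ℝ) * (vonMangoldt m / m) = 2 * (vonMangoldt m * ((N : ℝ) / m / 2)) := by ring
          _ ≤ _ := by
            gcongr
    _ ≤ N * (2 * Real.log N) := by linarith

open Finset ArithmeticFunction in
theorem sum_divisors_vonMangoldt_div_le {n : ℕ} (hlog : 1 ≤ Real.log n) :
    ∑ m ∈ n.divisors, vonMangoldt m / m ≤ 2 * Real.log (Real.log n) + 1 := by
  have hL : 0 < Real.log n := by linarith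
  set N := ⌊Real.log n⌋₊
  have hN : 0 < N := Nat.floor_pos.2 hlog
  rw [← sum_filter_add_sum_filter_not n.divisors (· ≤ N)]
  refine add_le_add ?_ ?_
  · calc ∑ m ∈ n.divisors with m ≤ N, vonMangoldt m / m
        ≤ ∑ m ∈ Ioc 0 N, vonMangoldt m / m := by
          refine sum_le_sum_of_subset_of_nonneg (fun m hm => ?_) fun m _ _ =>
            div_nonneg vonMangoldt_nonneg m.cast_nonneg
          rw [mem_filter] at hm
          exact mem_Ioc.2 ⟨Nat.pos_of_mem_divisors hm.1, hm.2⟩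
      _ ≤ 2 * Real.log N := sum_vonMangoldt_div_le N
      _ ≤ 2 * Real.log (Real.log n) := by
          gcongr
          exact Nat.floor_le hL.le
  · calc ∑ m ∈ n.divisors with ¬ m ≤ N, vonMangoldt m / m
        ≤ ∑ m ∈ n.divisors with ¬ m ≤ N, vonMangoldt m / Real.log n := by
          refine sum_le_sum fun m hm => ?_
          rw [mem_filter, not_le] at hm
          exact div_le_div_of_nonneg_left vonMangoldt_nonneg hL
            ((Nat.floor_lt hL.le).1 hm.2).le
      _ ≤ ∑ m ∈ n.divisors, vonMangoldt m / Real.log n :=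
          sum_le_sum_of_subset_of_nonneg (filter_subset _ _) fun m _ _ =>
            div_nonneg vonMangoldt_nonneg hL.le
      _ = 1 := by rw [← sum_div, vonMangoldt_sum, div_self hL.ne']

open Finset ArithmeticFunction in
theorem sum_divisors_log_div_le_mul (n : ℕ) :
    ∑ d ∈ n.divisors, Real.log d / d ≤
      (∑ m ∈ n.divisors, vonMangoldt m / m) * ∑ e ∈ n.divisors, (1 : ℝ) / e := by
  rw [sum_mul_sum, ← sum_product']
  have hnonneg (p : ℕ × ℕ) : 0 ≤ vonMangoldt p.1 / p.1 * ((1 : ℝ) / p.2) :=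
    mul_nonneg (div_nonneg vonMangoldt_nonneg (Nat.cast_nonneg _)) (by positivity)
  refine le_trans (le_of_eq (sum_congr rfl fun d hd => ?_))
    (sum_fiberwise_le_sum_of_sum_fiber_nonneg (t := n.divisors) (g := fun p => p.1 * p.2)
      fun _ _ => sum_nonneg fun p _ => hnonneg p)
  have hfiber : {p ∈ n.divisors ×ˢ n.divisors | p.1 * p.2 = d} = d.divisorsAntidiagonal := by
    ext p
    rw [Nat.mem_divisors] at hd
    simp only [mem_filter, mem_product, Nat.mem_divisors, Nat.mem_divisorsAntidiagonal]
    refine ⟨fun h => ⟨h.2, ne_zero_of_dvd_ne_zero hd.2 hd.1⟩, fun h => ?_⟩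
    exact ⟨⟨⟨(Dvd.intro _ h.1).trans hd.1, hd.2⟩, (Dvd.intro_left _ h.1).trans hd.1, hd.2⟩, h.1⟩
  rw [hfiber, Nat.sum_divisorsAntidiagonal fun a b => vonMangoldt a / a * ((1 : ℝ) / b),
    ← vonMangoldt_sum, sum_div]
  refine sum_congr rfl fun m hm => ?_
  have hd0 : (d : ℝ) ≠ 0 := by exact_mod_cast (Nat.pos_of_mem_divisors hd).ne'
  have hm0 : (m : ℝ) ≠ 0 := by exact_mod_cast (Nat.pos_of_mem_divisors hm).ne'
  rw [Nat.cast_div (Nat.dvd_of_mem_divisors hm) hm0]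
  field_simp

open Finset in
theorem sum_divisors_one_div_le (n : ℕ) {B : ℝ} (hB : 0 < B)
    (h : ∑ d ∈ n.divisors, Real.log d / d ≤ B * ∑ d ∈ n.divisors, (1 : ℝ) / d) :
    ∑ d ∈ n.divisors, (1 : ℝ) / d ≤ 2 + 4 * B := by
  set N := ⌊Real.exp (2 * B)⌋₊
  have hexp := Real.exp_pos (2 * B)
  have hN : 0 < N := Nat.floor_pos.2 (Real.one_le_exp (by linarith))
  have hsmall : ∑ d ∈ n.divisors with d ≤ N, (1 : ℝ) / d ≤ 1 + 2 * B := by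
    calc ∑ d ∈ n.divisors with d ≤ N, (1 : ℝ) / d
        ≤ ∑ d ∈ Icc 1 N, (1 : ℝ) / d := by
          refine sum_le_sum_of_subset_of_nonneg (fun m hm => ?_) fun m _ _ => by positivity
          rw [mem_filter] at hm
          exact mem_Icc.2 ⟨Nat.pos_of_mem_divisors hm.1, hm.2⟩
      _ = (harmonic N : ℝ) := by simp [harmonic_eq_sum_Icc]
      _ ≤ 1 + Real.log N := harmonic_le_one_add_log N
      _ ≤ 1 + 2 * B := by
          gcongr
          rw [Real.log_le_iff_le_exp (by exact_mod_cast hN)]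
          exact Nat.floor_le hexp.le
  have hlarge : 2 * B * ∑ d ∈ n.divisors with ¬ d ≤ N, (1 : ℝ) / d ≤
      ∑ d ∈ n.divisors, Real.log d / d := by
    calc 2 * B * ∑ d ∈ n.divisors with ¬ d ≤ N, (1 : ℝ) / d
        ≤ ∑ d ∈ n.divisors with ¬ d ≤ N, Real.log d / d := by
          rw [mul_sum]
          refine sum_le_sum fun d hd => ?_
          rw [mem_filter, not_le] at hd
          rw [mul_one_div]
          gcongr
          rw [Real.le_log_iff_exp_le (by exact_mod_cast hN.trans hd.2)]
          exact ((Nat.floor_lt hexp.le).1 hd.2).le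
      _ ≤ _ := sum_le_sum_of_subset_of_nonneg (filter_subset _ _) fun m _ _ =>
          div_nonneg (Real.log_natCast_nonneg m) m.cast_nonneg
  have hle := hlarge.trans h
  rw [mul_comm 2 B, mul_assoc] at hle
  have hle := le_of_mul_le_mul_left hle hB
  rw [← sum_filter_add_sum_filter_not n.divisors (· ≤ N)] at hle ⊢
  linarith

/-- `Σ_{d∣n} (log d)/d ≪ (log log n)²`. -/
theorem sum_log_div_divisor_le :
    ∃ C > (0 : ℝ), ∀ n : ℕ, 3 ≤ n →
      ∑ d ∈ n.divisors, Real.log d / d ≤ C * (Real.log (Real.log n)) ^ 2 := by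
  have hlog3 : 1 < Real.log 3 := by
    rw [Real.lt_log_iff_exp_lt (by norm_num)]
    exact Real.exp_one_lt_d9.trans (by norm_num)
  set c := Real.log (Real.log 3)
  have hc : 0 < c := Real.log_pos hlog3
  refine ⟨6 * (2 + 1 / c) ^ 2, by positivity, fun n hn => ?_⟩
  have hlog : Real.log 3 ≤ Real.log n := Real.log_le_log (by norm_num) (by exact_mod_cast hn)
  have hcn : c ≤ Real.log (Real.log n) := Real.log_le_log (by linarith) hlog
  set l := Real.log (Real.log n)
  set B := 2 * l + 1 with hBdef
  have hB : 1 ≤ B := by linarith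
  have hS : 0 ≤ ∑ d ∈ n.divisors, (1 : ℝ) / d := Finset.sum_nonneg fun _ _ => by positivity
  have hT : ∑ d ∈ n.divisors, Real.log d / d ≤ B * ∑ d ∈ n.divisors, (1 : ℝ) / d :=
    (sum_divisors_log_div_le_mul n).trans <| mul_le_mul_of_nonneg_right
      (sum_divisors_vonMangoldt_div_le (by linarith)) hS
  have hSB := sum_divisors_one_div_le n (by linarith) hT
  have hBl : B ≤ (2 + 1 / c) * l := by
    have : 1 ≤ 1 / c * l := by
      rw [one_div_mul_eq_div]
      exact (one_le_div hc).2 hcn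
    linarith
  calc ∑ d ∈ n.divisors, Real.log d / d ≤ B * (2 + 4 * B) := hT.trans (by gcongr)
    _ ≤ 6 * B ^ 2 := by nlinarith
    _ ≤ 6 * ((2 + 1 / c) * l) ^ 2 := by gcongr
    _ = 6 * (2 + 1 / c) ^ 2 * l ^ 2 := by ring
end

section
/- There exists an absolute constant C > 0 such that for every integer n ≥ 2 and every real Y with n^{7/8} ≤ Y < n, one has Σ_{x = 1}^{⌊Y⌋} d(n² − x²) ≤ C·Y·(log n)³. -/
/-- Triples of positive integers up to `N` whose product is at most `N ^ (3 / 4)`. -/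
def smallTriples (N : ℕ) : Finset (ℕ × ℕ × ℕ) :=
  {t ∈ Finset.Icc 1 N ×ˢ Finset.Icc 1 N ×ˢ Finset.Icc 1 N | (t.1 * t.2.1 * t.2.2) ^ 4 ≤ N ^ 3}

theorem mem_smallTriples_of_mul_eq {N m x y z w : ℕ} (hm : 0 < m) (hmN : m ≤ N)
    (h : x * y * z * w = m) (hx : x ≤ w) (hy : y ≤ w) (hz : z ≤ w) :
    (x, y, z) ∈ {t ∈ smallTriples N | t.1 * t.2.1 * t.2.2 ∣ m} := by
  have hle : ∀ k, k ∣ m → 1 ≤ k ∧ k ≤ N := fun k hk =>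
    ⟨Nat.pos_of_dvd_of_pos hk hm, (Nat.le_of_dvd hm hk).trans hmN⟩
  have h1 : x ∣ m := ⟨y * z * w, by rw [← h]; ring⟩
  have h2 : y ∣ m := ⟨x * z * w, by rw [← h]; ring⟩
  have h3 : z ∣ m := ⟨x * y * w, by rw [← h]; ring⟩
  have h4 : (x * y * z) ^ 4 ≤ N ^ 3 :=
    calc (x * y * z) ^ 4 = (x * y * z) ^ 3 * (x * y * z) := by ring
      _ ≤ (x * y * z) ^ 3 * (w * w * w) := by gcongr
      _ = m ^ 3 := by rw [← h]; ring
      _ ≤ N ^ 3 := by gcongr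
  simp only [smallTriples, Finset.mem_filter, Finset.mem_product, Finset.mem_Icc]
  exact ⟨⟨⟨hle x h1, hle y h2, hle z h3⟩, h4⟩, ⟨w, h.symm⟩⟩

theorem exists_quadruple_of_dvd {m a b : ℕ} (hm : 0 < m) (ha : a ∣ m) (hb : b ∣ m) :
    ∃ g u v e, g * u * v * e = m ∧ a = g * u ∧ b = g * v := by
  obtain ⟨e, he⟩ := Nat.lcm_dvd ha hb
  have hg : 0 < a.gcd b := Nat.gcd_pos_of_pos_left _ (Nat.pos_of_dvd_of_pos ha hm)
  obtain ⟨u, hu⟩ := Nat.gcd_dvd_left a b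
  obtain ⟨v, hv⟩ := Nat.gcd_dvd_right a b
  refine ⟨a.gcd b, u, v, e, ?_, hu, hv⟩
  have hl : a.gcd b * u * v = a.lcm b := by
    apply Nat.eq_of_mul_eq_mul_left hg
    rw [Nat.gcd_mul_lcm]
    calc a.gcd b * (a.gcd b * u * v) = (a.gcd b * u) * (a.gcd b * v) := by ring
      _ = a * b := by rw [← hu, ← hv]
  rw [hl, he]

theorem card_divisors_sq_le {N m : ℕ} (hm : 0 < m) (hmN : m ≤ N) :
    m.divisors.card ^ 2 ≤ 4 * {t ∈ smallTriples N | t.1 * t.2.1 * t.2.2 ∣ m}.card := by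
  set T := {t ∈ smallTriples N | t.1 * t.2.1 * t.2.2 ∣ m}
  let c : ℕ × ℕ × ℕ → ℕ := fun t => m / (t.1 * t.2.1 * t.2.2)
  have hc : ∀ {x y z w : ℕ}, x * y * z * w = m → c (x, y, z) = w := by
    intro x y z w h
    have : 0 < x * y * z := Nat.pos_of_mul_pos_right (h ▸ hm)
    simp only [c, ← h]
    exact Nat.mul_div_cancel_left w this
  have hsub : m.divisors ×ˢ m.divisors ⊆
      (T.image (fun t => (t.1 * t.2.1, t.1 * t.2.2)) ∪
        T.image (fun t => (c t * t.1, c t * t.2.1))) ∪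
      (T.image (fun t => (t.1 * c t, t.1 * t.2.1)) ∪
        T.image (fun t => (t.1 * t.2.1, t.1 * c t))) := by
    rintro ⟨a, b⟩ hab
    simp only [Finset.mem_product, Nat.mem_divisors] at hab
    obtain ⟨g, u, v, e, h, rfl, rfl⟩ := exists_quadruple_of_dvd hm hab.1.1 hab.2.1
    simp only [Finset.mem_union, Finset.mem_image]
    have he : g ≤ e ∧ u ≤ e ∧ v ≤ e ∨ u ≤ g ∧ v ≤ g ∧ e ≤ g ∨ g ≤ u ∧ v ≤ u ∧ e ≤ u ∨
        g ≤ v ∧ u ≤ v ∧ e ≤ v := by omega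
    rcases he with ⟨h1, h2, h3⟩ | ⟨h1, h2, h3⟩ | ⟨h1, h2, h3⟩ | ⟨h1, h2, h3⟩
    · exact .inl (.inl ⟨(g, u, v), mem_smallTriples_of_mul_eq hm hmN h h1 h2 h3, rfl⟩)
    · have h' : u * v * e * g = m := by rw [← h]; ring
      exact .inl (.inr ⟨(u, v, e), mem_smallTriples_of_mul_eq hm hmN h' h1 h2 h3, by
        simp only [hc h']⟩)
    · have h' : g * v * e * u = m := by rw [← h]; ring
      exact .inr (.inl ⟨(g, v, e), mem_smallTriples_of_mul_eq hm hmN h' h1 h2 h3, by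
        simp only [hc h']⟩)
    · have h' : g * u * e * v = m := by rw [← h]; ring
      exact .inr (.inr ⟨(g, u, e), mem_smallTriples_of_mul_eq hm hmN h' h1 h2 h3, by
        simp only [hc h']⟩)
  have hcard := (Finset.card_le_card hsub).trans (Finset.card_union_le _ _)
  rw [Finset.card_product, ← sq] at hcard
  refine hcard.trans ?_
  grw [Finset.card_union_le, Finset.card_union_le, Finset.card_image_le, Finset.card_image_le,
    Finset.card_image_le, Finset.card_image_le]
  omega

theorem card_Ioc_filter_dvd_le (A L P : ℕ) (hP : 0 < P) :
    (({m ∈ Finset.Ioc A (A + L) | P ∣ m}.card : ℕ) : ℝ) ≤ (L : ℝ) / P + 1 := by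
  have hu : ({m ∈ Finset.Ioc 0 (A + L) | P ∣ m}).card =
      ({m ∈ Finset.Ioc 0 A | P ∣ m}).card + ({m ∈ Finset.Ioc A (A + L) | P ∣ m}).card := by
    rw [← Finset.Ioc_union_Ioc_eq_Ioc (Nat.zero_le A) (Nat.le_add_right A L),
      Finset.filter_union, Finset.card_union_of_disjoint]
    exact Finset.disjoint_filter_filter (Finset.Ioc_disjoint_Ioc_of_le le_rfl)
  rw [Nat.Ioc_filter_dvd_card_eq_div, Nat.Ioc_filter_dvd_card_eq_div] at hu
  have hu' : (((A + L) / P : ℕ) : ℝ) = ((A / P : ℕ) : ℝ) +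
      (({m ∈ Finset.Ioc A (A + L) | P ∣ m}.card : ℕ) : ℝ) := by exact_mod_cast hu
  have h1 : (((A + L) / P : ℕ) : ℝ) ≤ ((A + L : ℕ) : ℝ) / P := Nat.cast_div_le
  have h2 : (A : ℝ) / P < ((A / P : ℕ) : ℝ) + 1 := by
    rw [div_lt_iff₀ (by exact_mod_cast hP)]
    exact_mod_cast Nat.lt_mul_of_div_lt (Nat.lt_succ_self (A / P)) hP
  push_cast [add_div] at h1
  linarith

/-- Mean square of the divisor function over an interval of length `L` inside `[1, N]`. -/
theorem sum_card_divisors_sq_le {N A L : ℕ} {K : ℝ} (hN : A + L ≤ N) (hK : 0 ≤ K)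
    (hNK : (N : ℝ) ^ 3 ≤ K ^ 4) :
    ∑ m ∈ Finset.Ioc A (A + L), (m.divisors.card : ℝ) ^ 2 ≤
      4 * (L + K) * (1 + Real.log N) ^ 3 := by
  let f : ℕ × ℕ × ℕ → ℝ := fun t => (t.1 : ℝ)⁻¹ * ((t.2.1 : ℝ)⁻¹ * (t.2.2 : ℝ)⁻¹)
  have hH : ∑ k ∈ Finset.Icc 1 N, (k : ℝ)⁻¹ ≤ 1 + Real.log N := by
    have := harmonic_le_one_add_log N
    rw [harmonic_eq_sum_Icc] at this
    push_cast at this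
    exact this
  calc ∑ m ∈ Finset.Ioc A (A + L), (m.divisors.card : ℝ) ^ 2
      ≤ ∑ m ∈ Finset.Ioc A (A + L),
          (4 * ({t ∈ smallTriples N | t.1 * t.2.1 * t.2.2 ∣ m}.card : ℕ) : ℝ) := by
        refine Finset.sum_le_sum fun m hm => ?_
        rw [Finset.mem_Ioc] at hm
        exact_mod_cast card_divisors_sq_le (by omega : 0 < m) (by omega)
    _ = 4 * ∑ t ∈ smallTriples N,
          (({m ∈ Finset.Ioc A (A + L) | t.1 * t.2.1 * t.2.2 ∣ m}.card : ℕ) : ℝ) := by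
        rw [← Finset.mul_sum]
        congr 1
        exact_mod_cast Finset.sum_card_bipartiteAbove_eq_sum_card_bipartiteBelow
          (s := Finset.Ioc A (A + L)) (t := smallTriples N)
          (fun m t => t.1 * t.2.1 * t.2.2 ∣ m)
    _ ≤ 4 * ∑ t ∈ smallTriples N, (L + K) * f t := by
        gcongr with t ht
        simp only [smallTriples, Finset.mem_filter, Finset.mem_product, Finset.mem_Icc] at ht
        obtain ⟨⟨h1, h2, h3⟩, h4⟩ := ht
        have hP : 0 < t.1 * t.2.1 * t.2.2 := Nat.mul_pos (Nat.mul_pos h1.1 h2.1) h3.1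
        have hP' : (0 : ℝ) < ((t.1 * t.2.1 * t.2.2 : ℕ) : ℝ) := by exact_mod_cast hP
        have hPK : ((t.1 * t.2.1 * t.2.2 : ℕ) : ℝ) ≤ K := by
          refine le_of_pow_le_pow_left₀ four_ne_zero hK (le_trans ?_ hNK)
          exact_mod_cast h4
        have hf : f t = (((t.1 * t.2.1 * t.2.2 : ℕ) : ℝ))⁻¹ := by
          simp only [f]
          push_cast
          rw [mul_inv, mul_inv, mul_assoc]
        refine (card_Ioc_filter_dvd_le A L _ hP).trans ?_
        rw [hf, add_mul, ← div_eq_mul_inv, ← div_eq_mul_inv]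
        gcongr
        rwa [one_le_div hP']
    _ ≤ 4 * ∑ t ∈ Finset.Icc 1 N ×ˢ Finset.Icc 1 N ×ˢ Finset.Icc 1 N, (L + K) * f t := by
        gcongr 4 * ?_
        exact Finset.sum_le_sum_of_subset_of_nonneg (Finset.filter_subset _ _)
          fun t _ _ => by positivity
    _ = 4 * (L + K) * (∑ k ∈ Finset.Icc 1 N, (k : ℝ)⁻¹) ^ 3 := by
        rw [← Finset.mul_sum, Finset.sum_product]
        simp only [f, ← Finset.mul_sum, Finset.sum_product, ← Finset.sum_mul]
        ring
    _ ≤ 4 * (L + K) * (1 + Real.log N) ^ 3 := by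
        gcongr

theorem sum_Icc_divisors_sub_sq_le {n L : ℕ} (hL : L < n) {K : ℝ} (hK : 0 ≤ K)
    (hNK : ((2 * n : ℕ) : ℝ) ^ 3 ≤ K ^ 4) :
    ∑ x ∈ Finset.Icc 1 L, ((n ^ 2 - x ^ 2).divisors.card : ℝ) ≤
      4 * (L + K) * (1 + Real.log (2 * n : ℕ)) ^ 3 := by
  have hadd : ∑ x ∈ Finset.Icc 1 L, ((n + x).divisors.card : ℝ) ^ 2 =
      ∑ m ∈ Finset.Ioc n (n + L), (m.divisors.card : ℝ) ^ 2 := by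
    refine Finset.sum_nbij' (n + ·) (· - n) ?_ ?_ ?_ ?_ (fun _ _ => rfl) <;>
      simp only [Finset.mem_Icc, Finset.mem_Ioc] <;> intros <;> omega
  have hsub : ∑ x ∈ Finset.Icc 1 L, ((n - x).divisors.card : ℝ) ^ 2 =
      ∑ m ∈ Finset.Ioc (n - L - 1) (n - L - 1 + L), (m.divisors.card : ℝ) ^ 2 := by
    refine Finset.sum_nbij' (n - ·) (n - ·) ?_ ?_ ?_ ?_ (fun _ _ => rfl) <;>
      simp only [Finset.mem_Icc, Finset.mem_Ioc] <;> intros <;> omega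
  have h1 := sum_card_divisors_sq_le (N := 2 * n) (A := n) (L := L) (by omega) hK hNK
  have h2 := sum_card_divisors_sq_le (N := 2 * n) (A := n - L - 1) (L := L) (by omega) hK hNK
  rw [← hadd] at h1
  rw [← hsub] at h2
  have h3 : ∑ x ∈ Finset.Icc 1 L, ((n ^ 2 - x ^ 2).divisors.card : ℝ) ≤
      ∑ x ∈ Finset.Icc 1 L,
        (((n + x).divisors.card : ℝ) ^ 2 + ((n - x).divisors.card : ℝ) ^ 2) / 2 := by
    refine Finset.sum_le_sum fun x _ => ?_
    have h : ((n ^ 2 - x ^ 2).divisors.card : ℝ) ≤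
        ((n + x).divisors.card : ℝ) * ((n - x).divisors.card : ℝ) := by
      rw [Nat.sq_sub_sq, Nat.divisors_mul]
      exact_mod_cast Finset.card_mul_le
    nlinarith [sq_nonneg (((n + x).divisors.card : ℝ) - ((n - x).divisors.card : ℝ))]
  rw [← Finset.sum_div, Finset.sum_add_distrib] at h3
  linarith

/-- `Σ_{1 ≤ x ≤ Y} d(n² − x²) ≪ Y (log n)³` for `n^{7/8} ≤ Y < n`. -/
theorem sum_divisorCount_diff_squares_le :
    ∃ C > (0 : ℝ), ∀ n : ℕ, 2 ≤ n → ∀ Y : ℝ,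
      (n : ℝ) ^ ((7 : ℝ) / 8) ≤ Y → Y < (n : ℝ) →
      ∑ x ∈ Finset.Icc 1 ⌊Y⌋₊, ((n ^ 2 - x ^ 2).divisors.card : ℝ)
        ≤ C * Y * (Real.log n) ^ 3 := by
  refine ⟨768, by norm_num, fun n hn Y hY hYn => ?_⟩
  have hn' : (2 : ℝ) ≤ n := by exact_mod_cast hn
  have hY0 : 0 ≤ Y := le_trans (by positivity) hY
  have hL : ⌊Y⌋₊ < n := (Nat.floor_lt hY0).2 hYn
  have hNK : ((2 * n : ℕ) : ℝ) ^ 3 ≤ (2 * Y) ^ 4 := by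
    have h : (n : ℝ) ^ 3 ≤ Y ^ 4 :=
      calc (n : ℝ) ^ 3 = (n : ℝ) ^ (3 : ℝ) := by norm_cast
        _ ≤ (n : ℝ) ^ ((7 : ℝ) / 8 * (4 : ℕ)) :=
          Real.rpow_le_rpow_of_exponent_le (by linarith) (by norm_num)
        _ = ((n : ℝ) ^ ((7 : ℝ) / 8)) ^ 4 := Real.rpow_mul_natCast (by positivity) _ _
        _ ≤ Y ^ 4 := by gcongr
    push_cast
    rw [mul_pow, mul_pow]
    nlinarith [pow_nonneg hY0 4]
  have hlog : 1 + Real.log (2 * n : ℕ) ≤ 4 * Real.log n := by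
    push_cast
    rw [Real.log_mul two_ne_zero (by positivity)]
    have h1 := Real.log_two_gt_d9
    have h2 : Real.log 2 ≤ Real.log n := Real.log_le_log two_pos hn'
    linarith
  have hlog0 : 0 ≤ Real.log (2 * n : ℕ) := Real.log_natCast_nonneg _
  calc ∑ x ∈ Finset.Icc 1 ⌊Y⌋₊, ((n ^ 2 - x ^ 2).divisors.card : ℝ)
      ≤ 4 * (⌊Y⌋₊ + 2 * Y) * (1 + Real.log (2 * n : ℕ)) ^ 3 :=
        sum_Icc_divisors_sub_sq_le hL (by positivity) hNK
    _ ≤ 4 * (Y + 2 * Y) * (4 * Real.log n) ^ 3 := by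
        gcongr
        exact Nat.floor_le hY0
    _ = 768 * Y * (Real.log n) ^ 3 := by ring
end
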